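/- arXiv:math/0310285 — 2 statements merged into one kernel-verified Lean document; each statement's English description precedes it below -/
import Mathlib

section
/- Euler–Maclaurin analogue for a periodic weight (Theorem 1(I)): Let k ≥ 1 be an integer, let χ : ℤ → ℂ satisfy χ(n + k) = χ(n) for all n, let R ≥ 0 be an integer, let a < b be real numbers with a, b ∉ ℤ, and let f : ℝ → ℂ have continuous derivatives up to order R + 1 on [a,b]. Then all the symmetric series below converge and Σ_{a < n ≤ b} χ(n) f(n) = (1/k) Σ_{l=1}^{k} χ(l) ∫_a^b f(u) du + Σ_{r=0}^{R} (−k)^r · { f^{(r)}(b) · Σ′_n τ(χ,−n) e^{2πinb/k}/(2πin)^{r+1} − f^{(r)}(a) · Σ′_n τ(χ,−n) e^{2πina/k}/(2πin)^{r+1} } − (−k)^R · Σ′_n ( τ(χ,−n)/(2πin)^{R+1} ) ∫_a^b f^{(R+1)}(u) e^{2πinu/k} du. -/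
open MeasureTheory intervalIntegral Filter

/-- `e(z) = exp(2πiz)`. -/
noncomputable def ee (z : ℂ) : ℂ := Complex.exp (2 * (Real.pi : ℂ) * Complex.I * z)

/-- `2πin`. -/
noncomputable def twoPiI (n : ℤ) : ℂ := 2 * (Real.pi : ℂ) * Complex.I * (n : ℂ)

/-- The symmetric limit `lim_{N→∞} ∑_{1 ≤ |n| ≤ N} g n = L` over nonzero integers. -/
def SymTendsto (g : ℤ → ℂ) (L : ℂ) : Prop :=
  Tendsto (fun N : ℕ => ∑ n ∈ (Finset.Icc (-(N : ℤ)) (N : ℤ)).erase 0, g n) atTop (nhds L)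

/-- Gauss-type sum `τ(χ, n) = ∑_{l=1}^{k} χ(l) e^{2πinl/k}`. -/
noncomputable def tauSum (k : ℕ) (χ : ℤ → ℂ) (n : ℤ) : ℂ :=
  ∑ l ∈ Finset.Icc (1 : ℤ) (k : ℤ), χ l * ee ((n : ℂ) * (l : ℂ) / (k : ℂ))

/-- The partial sum `∑_{n=1}^{N} sin(2πnx)/(πn)` of the Fourier series of the sawtooth function
`1/2 - {x}`. -/
noncomputable def sawSum (N : ℕ) (x : ℝ) : ℝ :=
  ∑ n ∈ Finset.range N, Real.sin (2 * Real.pi * (n + 1) * x) / (Real.pi * (n + 1))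

lemma sin_mul_dirichlet_kernel (N : ℕ) (x : ℝ) :
    Real.sin (Real.pi * x) *
        (1 + ∑ n ∈ Finset.range N, 2 * Real.cos (2 * Real.pi * (n + 1) * x)) =
      Real.sin ((2 * N + 1) * Real.pi * x) := by
  induction N with
  | zero => simp
  | succ N ih =>
    rw [Finset.sum_range_succ, ← add_assoc, mul_add, ih]
    have h1 : (2 * (N : ℝ) + 1) * Real.pi * x
        = 2 * Real.pi * (N + 1) * x - Real.pi * x := by ring
    have h2 : (2 * ((N + 1 : ℕ) : ℝ) + 1) * Real.pi * x
        = 2 * Real.pi * (N + 1) * x + Real.pi * x := by push_cast; ring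
    rw [h1, h2, Real.sin_add, Real.sin_sub]
    ring

lemma hasDerivAt_sawSum (N : ℕ) (x : ℝ) :
    HasDerivAt (sawSum N)
      (∑ n ∈ Finset.range N, 2 * Real.cos (2 * Real.pi * (n + 1) * x)) x := by
  unfold sawSum
  refine HasDerivAt.fun_sum fun n _ => ?_
  have h := (((hasDerivAt_id x).const_mul (2 * Real.pi * ((n : ℝ) + 1))).sin).div_const
    (Real.pi * ((n : ℝ) + 1))
  refine h.congr_deriv ?_
  have : (n : ℝ) + 1 ≠ 0 := by positivity
  simp only [id]
  field_simp

lemma sawSum_half (N : ℕ) : sawSum N (1 / 2) = 0 := by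
  refine Finset.sum_eq_zero fun n _ => ?_
  have : 2 * Real.pi * ((n : ℝ) + 1) * (1 / 2) = ((n + 1 : ℕ) : ℝ) * Real.pi := by
    push_cast; ring
  rw [this, Real.sin_nat_mul_pi, zero_div]

lemma sawSum_one_sub (N : ℕ) (x : ℝ) : sawSum N (1 - x) = -sawSum N x := by
  unfold sawSum
  rw [← Finset.sum_neg_distrib]
  refine Finset.sum_congr rfl fun n _ => ?_
  have : 2 * Real.pi * ((n : ℝ) + 1) * (1 - x)
      = ((n + 1 : ℕ) : ℝ) * (2 * Real.pi) - 2 * Real.pi * (n + 1) * x := by push_cast; ring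
  rw [this, Real.sin_nat_mul_two_pi_sub, neg_div]

lemma sawSum_fract (N : ℕ) (x : ℝ) : sawSum N (Int.fract x) = sawSum N x := by
  refine Finset.sum_congr rfl fun n _ => ?_
  have : 2 * Real.pi * ((n : ℝ) + 1) * Int.fract x
      = 2 * Real.pi * (n + 1) * x - (((n + 1 : ℤ) * ⌊x⌋ : ℤ) : ℝ) * (2 * Real.pi) := by
    rw [Int.fract]; push_cast; ring
  rw [this, Real.sin_sub_int_mul_two_pi]

/-- The derivative of the error `sawSum N x - (1/2 - x)` plus a correction term; for `c = ±1` it has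
a constant sign on `(0, 1/2]`. -/
lemma hasDerivAt_sawSum_correction (N : ℕ) (c : ℝ) {x : ℝ} (hx : Real.sin (Real.pi * x) ≠ 0) :
    HasDerivAt (fun y => sawSum N y - (1 / 2 - y) +
        (Real.cos ((2 * N + 1) * Real.pi * y) - c) /
          ((2 * N + 1) * Real.pi * Real.sin (Real.pi * y)))
      ((c - Real.cos ((2 * N + 1) * Real.pi * x)) * Real.cos (Real.pi * x) /
        ((2 * N + 1) * Real.sin (Real.pi * x) ^ 2)) x := by
  have hN : (2 * (N : ℝ) + 1) ≠ 0 := by positivity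
  have hpi := Real.pi_ne_zero
  have h1 := (((hasDerivAt_id x).const_mul ((2 * (N : ℝ) + 1) * Real.pi)).cos).sub_const c
  have h2 := (((hasDerivAt_id x).const_mul Real.pi).sin).const_mul ((2 * (N : ℝ) + 1) * Real.pi)
  have h3 := ((hasDerivAt_sawSum N x).sub ((hasDerivAt_id x).const_sub (1 / 2))).add
    (h1.div h2 (by simp [hN, hpi, hx]))
  refine h3.congr_deriv ?_
  have hd := sin_mul_dirichlet_kernel N x
  simp only [id]
  generalize (∑ n ∈ Finset.range N, 2 * Real.cos (2 * Real.pi * (n + 1) * x)) = D at hd ⊢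
  rw [← hd]
  field_simp
  ring

lemma abs_sawSum_sub_le_of_le_half (N : ℕ) {x : ℝ} (h0 : 0 < x) (h1 : x ≤ 1 / 2) :
    |sawSum N x - (1 / 2 - x)| ≤ 2 / ((2 * N + 1) * Real.pi * Real.sin (Real.pi * x)) := by
  have hpi := Real.pi_pos
  have hsin : ∀ y ∈ Set.Icc x (1 / 2), 0 < Real.sin (Real.pi * y) := fun y hy =>
    Real.sin_pos_of_pos_of_lt_pi (mul_pos hpi (h0.trans_le hy.1))
      (by nlinarith [hy.2])
  have hcos : ∀ y ∈ Set.Icc x (1 / 2), 0 ≤ Real.cos (Real.pi * y) := fun y hy =>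
    Real.cos_nonneg_of_neg_pi_div_two_le_of_le (by nlinarith [hy.1]) (by nlinarith [hy.2])
  have hK : 0 < (2 * (N : ℝ) + 1) * Real.pi := by positivity
  have hend : Real.cos ((2 * N + 1) * Real.pi * (1 / 2)) = 0 := by
    rw [Real.cos_eq_zero_iff]
    exact ⟨N, by push_cast; ring⟩
  have hx := hsin x ⟨le_rfl, h1⟩
  have hD := mul_pos hK hx
  have hle : (1 : ℝ) / ((2 * N + 1) * Real.pi) > 0 := by positivity
  have hle2 : 0 ≤ (Real.cos ((2 * N + 1) * Real.pi * x) + 1) /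
      ((2 * N + 1) * Real.pi * Real.sin (Real.pi * x)) :=
    div_nonneg (by linarith [Real.neg_one_le_cos ((2 * N + 1) * Real.pi * x)]) hD.le
  have hle3 : (Real.cos ((2 * N + 1) * Real.pi * x) - 1) /
      ((2 * N + 1) * Real.pi * Real.sin (Real.pi * x)) ≤ 0 :=
    div_nonpos_of_nonpos_of_nonneg
      (by linarith [Real.cos_le_one ((2 * N + 1) * Real.pi * x)]) hD.le
  have hmem : x ∈ Set.Icc x (1 / 2) := ⟨le_rfl, h1⟩
  have hmem' : (1 / 2 : ℝ) ∈ Set.Icc x (1 / 2) := ⟨h1, le_rfl⟩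
  have hs2 : Real.sin (Real.pi * (1 / 2)) = 1 := by
    rw [mul_one_div, Real.sin_pi_div_two]
  have key : 2 / ((2 * N + 1) * Real.pi * Real.sin (Real.pi * x)) =
      (Real.cos ((2 * N + 1) * Real.pi * x) + 1) /
        ((2 * N + 1) * Real.pi * Real.sin (Real.pi * x)) -
      (Real.cos ((2 * N + 1) * Real.pi * x) - 1) /
        ((2 * N + 1) * Real.pi * Real.sin (Real.pi * x)) := by
    rw [← sub_div]; ring
  rw [abs_le, key]
  constructor
  · have hanti := antitoneOn_of_hasDerivWithinAt_nonpos (convex_Icc x (1 / 2 : ℝ))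
      (fun y hy =>
        (hasDerivAt_sawSum_correction N (-1) (hsin y hy).ne').continuousAt.continuousWithinAt)
      (fun y hy => (hasDerivAt_sawSum_correction N (-1)
        (hsin y (interior_subset hy)).ne').hasDerivWithinAt)
      (fun y hy => by
        have hy := interior_subset hy
        refine div_nonpos_of_nonpos_of_nonneg (mul_nonpos_of_nonpos_of_nonneg ?_ (hcos y hy))
          (by positivity)
        linarith [Real.neg_one_le_cos ((2 * N + 1) * Real.pi * y)])
    have := hanti hmem hmem' h1
    simp only [sawSum_half, hend, hs2] at this
    norm_num at this hle ⊢
    linarith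
  · have hmono := monotoneOn_of_hasDerivWithinAt_nonneg (convex_Icc x (1 / 2 : ℝ))
      (fun y hy =>
        (hasDerivAt_sawSum_correction N 1 (hsin y hy).ne').continuousAt.continuousWithinAt)
      (fun y hy => (hasDerivAt_sawSum_correction N 1
        (hsin y (interior_subset hy)).ne').hasDerivWithinAt)
      (fun y hy => by
        have hy := interior_subset hy
        refine div_nonneg (mul_nonneg ?_ (hcos y hy)) (by positivity)
        linarith [Real.cos_le_one ((2 * N + 1) * Real.pi * y)])
    have := hmono hmem hmem' h1
    simp only [sawSum_half, hend, hs2] at this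
    have e : (0 - 1) / ((2 * (N : ℝ) + 1) * Real.pi * 1) = -(1 / ((2 * N + 1) * Real.pi)) := by
      rw [mul_one]; ring
    rw [e] at this
    linarith

lemma abs_sawSum_le_of_le_half (N : ℕ) {x : ℝ} (h0 : 0 ≤ x) (h1 : x ≤ 1 / 2) :
    |sawSum N x| ≤ 2 := by
  have hpi := Real.pi_gt_three
  rcases le_or_gt ((2 * (N : ℝ) + 1) * x) 1 with h | h
  · have : |sawSum N x| ≤ ∑ n ∈ Finset.range N, 2 * x := by
      refine (Finset.abs_sum_le_sum_abs _ _).trans (Finset.sum_le_sum fun n _ => ?_)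
      have hd : 0 < Real.pi * ((n : ℝ) + 1) := by positivity
      rw [abs_div, abs_of_pos hd, div_le_iff₀ hd]
      refine Real.abs_sin_le_abs.trans_eq ?_
      rw [abs_of_nonneg (by positivity)]
      ring
    rw [Finset.sum_const, Finset.card_range, nsmul_eq_mul] at this
    nlinarith
  · have hx : 0 < x := by
      rcases h0.eq_or_lt with rfl | h'
      · simp at h; linarith
      · exact h'
    have hj : 2 * x ≤ Real.sin (Real.pi * x) := by
      have := Real.mul_le_sin (x := Real.pi * x) (by positivity) (by nlinarith)
      refine le_trans (le_of_eq ?_) this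
      field_simp
    have hb := abs_sawSum_sub_le_of_le_half N hx h1
    have : 2 / ((2 * (N : ℝ) + 1) * Real.pi * Real.sin (Real.pi * x)) ≤ 1 := by
      have hN : 0 < 2 * (N : ℝ) + 1 := by positivity
      have h2 : (2 * (N : ℝ) + 1) * Real.pi * (2 * x)
          ≤ (2 * N + 1) * Real.pi * Real.sin (Real.pi * x) := by gcongr
      rw [div_le_one (by nlinarith)]
      nlinarith
    have h3 := abs_sub_abs_le_abs_sub (sawSum N x) (1 / 2 - x)
    rw [abs_of_nonneg (a := 1 / 2 - x) (by linarith)] at h3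
    linarith

lemma abs_sawSum_le (N : ℕ) (x : ℝ) : |sawSum N x| ≤ 2 := by
  rw [← sawSum_fract]
  have h0 := Int.fract_nonneg x
  have h1 := Int.fract_lt_one x
  rcases le_total (Int.fract x) (1 / 2) with h | h
  · exact abs_sawSum_le_of_le_half N h0 h
  · rw [← abs_neg, ← sawSum_one_sub]
    exact abs_sawSum_le_of_le_half N (by linarith) (by linarith)

lemma abs_sawSum_sub_le (N : ℕ) {x : ℝ} (h0 : 0 < x) (h1 : x < 1) :
    |sawSum N x - (1 / 2 - x)| ≤ 2 / ((2 * N + 1) * Real.pi * Real.sin (Real.pi * x)) := by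
  rcases le_total x (1 / 2) with h | h
  · exact abs_sawSum_sub_le_of_le_half N h0 h
  · have := abs_sawSum_sub_le_of_le_half N (x := 1 - x) (by linarith) (by linarith)
    rw [sawSum_one_sub, mul_sub, mul_one, Real.sin_pi_sub] at this
    rw [← abs_neg]
    convert this using 2
    ring

lemma tendsto_sawSum {x : ℝ} (hx : Int.fract x ≠ 0) :
    Tendsto (fun N => sawSum N x) atTop (nhds (1 / 2 - Int.fract x)) := by
  have h0 : 0 < Int.fract x := (Int.fract_nonneg x).lt_of_ne' hx
  have hbound : ∀ N, ‖sawSum N x - (1 / 2 - Int.fract x)‖ ≤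
      2 / ((2 * (N : ℝ) + 1) * (Real.pi * Real.sin (Real.pi * Int.fract x))) := fun N => by
    rw [← mul_assoc, Real.norm_eq_abs, ← sawSum_fract]
    exact abs_sawSum_sub_le N h0 (Int.fract_lt_one x)
  rw [tendsto_iff_norm_sub_tendsto_zero]
  refine squeeze_zero (fun _ => norm_nonneg _) hbound ?_
  refine Tendsto.const_div_atTop ?_ _
  have hs : 0 < Real.sin (Real.pi * Int.fract x) :=
    Real.sin_pos_of_pos_of_lt_pi (by positivity)
      (by nlinarith [Int.fract_lt_one x, Real.pi_pos])
  refine Tendsto.atTop_mul_const (mul_pos Real.pi_pos hs) ?_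
  exact tendsto_atTop_add_const_right _ _
    (tendsto_natCast_atTop_atTop.const_mul_atTop two_pos)

lemma ee_add (z w : ℂ) : ee (z + w) = ee z * ee w := by
  rw [ee, mul_add, Complex.exp_add]; rfl

lemma norm_ee_ofReal (x : ℝ) : ‖ee x‖ = 1 := by
  rw [ee, show 2 * (Real.pi : ℂ) * Complex.I * x = ((2 * Real.pi * x : ℝ) : ℂ) * Complex.I by
    push_cast; ring, Complex.norm_exp_ofReal_mul_I]

lemma twoPiI_ne_zero {n : ℤ} (hn : n ≠ 0) : twoPiI n ≠ 0 := by
  simp [twoPiI, hn, Real.pi_ne_zero]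

lemma norm_twoPiI (n : ℤ) : ‖twoPiI n‖ = 2 * Real.pi * |(n : ℝ)| := by
  simp [twoPiI, abs_of_pos Real.pi_pos]

lemma sum_Icc_neg_erase_zero {M : Type*} [AddCommMonoid M] (g : ℤ → M) (N : ℕ) :
    ∑ n ∈ (Finset.Icc (-(N : ℤ)) (N : ℤ)).erase 0, g n =
      ∑ n ∈ Finset.range N, (g (n + 1) + g (-(n + 1))) := by
  induction N with
  | zero => simp
  | succ N ih =>
    have : (Finset.Icc (-((N + 1 : ℕ) : ℤ)) ((N + 1 : ℕ) : ℤ)).erase 0 =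
        insert ((N : ℤ) + 1) (insert (-((N : ℤ) + 1))
          ((Finset.Icc (-(N : ℤ)) (N : ℤ)).erase 0)) := by
      ext m
      simp only [Finset.mem_erase, Finset.mem_Icc, Finset.mem_insert]
      push_cast
      omega
    rw [this, Finset.sum_insert, Finset.sum_insert, ih, Finset.sum_range_succ, ← add_assoc,
      add_comm]
    · simp
    · simp only [Finset.mem_insert, Finset.mem_erase, Finset.mem_Icc]
      omega

lemma sum_ee_div_twoPiI (N : ℕ) (x : ℝ) :
    ∑ n ∈ (Finset.Icc (-(N : ℤ)) (N : ℤ)).erase 0, ee (n * x) / twoPiI n =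
      (sawSum N x : ℂ) := by
  rw [sum_Icc_neg_erase_zero, sawSum, Complex.ofReal_sum]
  refine Finset.sum_congr rfl fun n _ => ?_
  have hn : (n : ℂ) + 1 ≠ 0 := by exact_mod_cast n.succ_ne_zero
  have hpi : (Real.pi : ℂ) ≠ 0 := by exact_mod_cast Real.pi_ne_zero
  simp only [ee, twoPiI]
  push_cast
  rw [Complex.sin]
  rw [show 2 * (Real.pi : ℂ) * Complex.I * (((n : ℂ) + 1) * x)
      = 2 * Real.pi * (n + 1) * x * Complex.I by ring,
    show 2 * (Real.pi : ℂ) * Complex.I * (-((n : ℂ) + 1) * x)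
      = -(2 * Real.pi * (n + 1) * x) * Complex.I by ring]
  field_simp
  rw [Complex.I_sq]
  ring

lemma tauSum_neg_mul_ee (k : ℕ) (χ : ℤ → ℂ) (n : ℤ) (u : ℝ) :
    tauSum k χ (-n) * ee ((n : ℂ) * (u : ℂ) / (k : ℂ)) =
      ∑ l ∈ Finset.Icc (1 : ℤ) (k : ℤ), χ l * ee (n * (((u - l) / k : ℝ) : ℂ)) := by
  rw [tauSum, Finset.sum_mul]
  refine Finset.sum_congr rfl fun l _ => ?_
  rw [mul_assoc, ← ee_add]
  congr 2
  push_cast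
  ring

/-- The partial sums of the Fourier series of `periodicSaw k χ`. -/
noncomputable def periodicSawSum (k : ℕ) (χ : ℤ → ℂ) (N : ℕ) (u : ℝ) : ℂ :=
  ∑ l ∈ Finset.Icc (1 : ℤ) (k : ℤ), χ l * (sawSum N ((u - l) / k) : ℂ)

/-- The sawtooth function `∑_{l=1}^{k} χ(l) (1/2 - {(u - l)/k})` attached to the weight `χ`. -/
noncomputable def periodicSaw (k : ℕ) (χ : ℤ → ℂ) (u : ℝ) : ℂ :=
  ∑ l ∈ Finset.Icc (1 : ℤ) (k : ℤ), χ l * ((1 / 2 - Int.fract ((u - l) / k) : ℝ) : ℂ)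

lemma sum_tauSum_mul_ee_div (k : ℕ) (χ : ℤ → ℂ) (N : ℕ) (u : ℝ) :
    ∑ n ∈ (Finset.Icc (-(N : ℤ)) (N : ℤ)).erase 0,
        tauSum k χ (-n) * ee ((n : ℂ) * (u : ℂ) / (k : ℂ)) / twoPiI n =
      periodicSawSum k χ N u := by
  simp_rw [tauSum_neg_mul_ee, Finset.sum_div, periodicSawSum, ← sum_ee_div_twoPiI,
    Finset.mul_sum, mul_div_assoc]
  exact Finset.sum_comm

lemma tendsto_periodicSawSum {k : ℕ} (hk : 1 ≤ k) (χ : ℤ → ℂ) {u : ℝ} (hu : ∀ n : ℤ, u ≠ n) :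
    Tendsto (fun N => periodicSawSum k χ N u) atTop (nhds (periodicSaw k χ u)) := by
  refine tendsto_finsetSum _ fun l _ => Tendsto.const_mul _ ?_
  refine (Complex.continuous_ofReal.tendsto _).comp (tendsto_sawSum ?_)
  intro h
  obtain ⟨m, hm⟩ := Int.fract_eq_zero_iff.1 h
  apply hu (m * k + l)
  have : (k : ℝ) ≠ 0 := by positivity
  field_simp at hm
  push_cast
  linarith

lemma norm_periodicSawSum_le (k : ℕ) (χ : ℤ → ℂ) (N : ℕ) (u : ℝ) :
    ‖periodicSawSum k χ N u‖ ≤ ∑ l ∈ Finset.Icc (1 : ℤ) (k : ℤ), ‖χ l‖ * 2 := by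
  refine (norm_sum_le _ _).trans (Finset.sum_le_sum fun l _ => ?_)
  rw [norm_mul, Complex.norm_real, Real.norm_eq_abs]
  gcongr
  exact abs_sawSum_le _ _

lemma continuous_periodicSawSum (k : ℕ) (χ : ℤ → ℂ) (N : ℕ) :
    Continuous (periodicSawSum k χ N) := by
  unfold periodicSawSum sawSum
  fun_prop

lemma norm_tauSum_le (k : ℕ) (χ : ℤ → ℂ) (n : ℤ) :
    ‖tauSum k χ n‖ ≤ ∑ l ∈ Finset.Icc (1 : ℤ) (k : ℤ), ‖χ l‖ := by
  refine (norm_sum_le _ _).trans (Finset.sum_le_sum fun l _ => ?_)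
  rw [norm_mul, show (n : ℂ) * l / k = ((n * l / k : ℝ) : ℂ) by push_cast; rfl, norm_ee_ofReal,
    mul_one]

lemma Summable.exists_symTendsto {g : ℤ → ℂ} (hg : Summable g) : ∃ L, SymTendsto g L := by
  refine ⟨(∑' n, g n) - g 0, ?_⟩
  have h := (hg.hasSum.comp (Finset.tendsto_Icc_neg (R := ℤ))).sub_const (g 0)
  refine h.congr fun N => ?_
  rw [Finset.sum_erase_eq_sub (by simp)]
  rfl

lemma exists_symTendsto_tauSum {k : ℕ} (hk : 1 ≤ k) (χ : ℤ → ℂ) {u : ℝ} (hu : ∀ n : ℤ, u ≠ n) :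
    ∃ T : ℕ → ℂ, T 0 = periodicSaw k χ u ∧ ∀ r, SymTendsto
      (fun n => tauSum k χ (-n) * ee ((n : ℂ) * (u : ℂ) / (k : ℂ)) / (twoPiI n) ^ (r + 1))
      (T r) := by
  have hsum : ∀ r, ∃ L, SymTendsto
      (fun n => tauSum k χ (-n) * ee ((n : ℂ) * (u : ℂ) / (k : ℂ)) / (twoPiI n) ^ (r + 2)) L := by
    intro r
    apply Summable.exists_symTendsto
    have hs : Summable fun n : ℤ => (1 : ℝ) / |(n : ℝ)| ^ (r + 2) := by
      have := (Real.summable_one_div_int_pow (p := r + 2)).2 (by omega)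
      simpa [abs_inv, abs_pow] using this.abs
    refine Summable.of_norm_bounded
      (hs.mul_left (∑ l ∈ Finset.Icc (1 : ℤ) (k : ℤ), ‖χ l‖)) fun n => ?_
    rw [norm_div, norm_mul, show (n : ℂ) * u / k = ((n * u / k : ℝ) : ℂ) by push_cast; rfl,
      norm_ee_ofReal, mul_one, norm_pow, norm_twoPiI, mul_one_div]
    rcases eq_or_ne n 0 with rfl | hn
    · simp
    have hn' : 0 < |(n : ℝ)| := by positivity
    gcongr
    · exact norm_tauSum_le _ _ _
    · nlinarith [Real.pi_gt_three]
  choose T hT using hsum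
  refine ⟨fun r => r.casesOn (periodicSaw k χ u) T, rfl, fun r => ?_⟩
  cases r with
  | zero =>
    simp only [SymTendsto, zero_add, pow_one, sum_tauSum_mul_ee_div]
    exact tendsto_periodicSawSum hk χ hu
  | succ r => exact hT r

lemma sum_Ioc_eq_sum_mul_floor {k : ℕ} (hk : 1 ≤ k) {χ : ℤ → ℂ}
    (hχ : ∀ n : ℤ, χ (n + (k : ℤ)) = χ n) {a u : ℝ} (hau : a ≤ u) :
    ∑ n ∈ Finset.Ioc ⌊a⌋ ⌊u⌋, χ n =
      ∑ l ∈ Finset.Icc (1 : ℤ) (k : ℤ), χ l * ((⌊(u - l) / k⌋ - ⌊(a - l) / k⌋ : ℤ) : ℂ) := by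
  have hk0 : (0 : ℤ) < k := by exact_mod_cast hk
  have hper : ∀ m n : ℤ, m ≡ n [ZMOD k] → χ m = χ n := by
    intro m n h
    obtain ⟨c, hc⟩ := h.symm.dvd
    have hp : Function.Periodic χ (k : ℤ) := hχ
    have := (hp.int_mul c) n
    rw [← this]
    congr 1
    simp only [Int.cast_id]
    linarith
  have hfloor : ∀ (v : ℝ) (l : ℤ), ⌊(v - l) / k⌋ = (⌊v⌋ - l) / k := by
    intro v l
    rw [Int.floor_div_natCast, Int.floor_sub_intCast]
  have hcard : ∀ l : ℤ, ((⌊(u - l) / k⌋ - ⌊(a - l) / k⌋ : ℤ) : ℂ) =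
      ∑ n ∈ Finset.Ioc ⌊a⌋ ⌊u⌋, if n ≡ l [ZMOD k] then 1 else 0 := by
    intro l
    have h := Int.Ioc_filter_modEq_card ⌊a⌋ ⌊u⌋ hk0 l
    have hq : ∀ m : ℤ, ⌊((m : ℚ) - l) / ((k : ℤ) : ℚ)⌋ = (m - l) / k := by
      intro m
      rw [← Int.cast_sub, Int.cast_natCast, Int.floor_div_natCast, Int.floor_intCast]
    rw [hq, hq, max_eq_left] at h
    · rw [Finset.sum_boole, hfloor, hfloor, ← h]
      simp
    · have := Int.ediv_le_ediv hk0 (sub_le_sub_right (Int.floor_le_floor hau) l)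
      linarith
  simp_rw [hcard, Finset.mul_sum]
  rw [Finset.sum_comm]
  refine Finset.sum_congr rfl fun n _ => ?_
  obtain ⟨l, ⟨hl, hnl⟩, huniq⟩ : ∃! l : ℤ, l ∈ Finset.Icc (1 : ℤ) k ∧ n ≡ l [ZMOD k] := by
    refine ⟨(n - 1) % k + 1, ⟨?_, ?_⟩, ?_⟩
    · rw [Finset.mem_Icc]
      have h1 := Int.emod_nonneg (n - 1) hk0.ne'
      have h2 := Int.emod_lt_of_pos (n - 1) hk0
      omega
    · have := (Int.mod_modEq (n - 1) k).symm.add_right 1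
      simpa using this
    · rintro y ⟨hy, hny⟩
      rw [Finset.mem_Icc] at hy
      have h3 : (n - 1) % k = (y - 1) % k := hny.sub_right 1
      rw [h3, Int.emod_eq_of_lt (by omega) (by omega)]
      ring
  rw [Finset.sum_eq_single_of_mem l hl]
  · rw [if_pos hnl, mul_one, hper n l hnl]
  · intro m hm hml
    rw [if_neg fun h => hml (huniq m ⟨hm, h⟩), mul_zero]

lemma sum_Ioc_eq_periodicSaw {k : ℕ} (hk : 1 ≤ k) {χ : ℤ → ℂ}
    (hχ : ∀ n : ℤ, χ (n + (k : ℤ)) = χ n) {a u : ℝ} (hau : a ≤ u) :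
    ∑ n ∈ Finset.Ioc ⌊a⌋ ⌊u⌋, χ n =
      (1 / (k : ℂ)) * (∑ l ∈ Finset.Icc (1 : ℤ) (k : ℤ), χ l) * (u - a) +
        periodicSaw k χ u - periodicSaw k χ a := by
  have hk0 : (k : ℂ) ≠ 0 := by exact_mod_cast (by omega : k ≠ 0)
  rw [sum_Ioc_eq_sum_mul_floor hk hχ hau, periodicSaw, periodicSaw, Finset.mul_sum,
    Finset.sum_mul, ← Finset.sum_add_distrib, ← Finset.sum_sub_distrib]
  refine Finset.sum_congr rfl fun l _ => ?_
  simp only [Int.fract]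
  push_cast
  field_simp
  ring

lemma integral_mul_ite_le {a b c : ℝ} (hac : a ≤ c) (hcb : c ≤ b) (g : ℝ → ℂ) :
    ∫ u in a..b, g u * (if c ≤ u then 1 else 0) = ∫ u in c..b, g u := by
  rw [integral_of_le (hac.trans hcb), integral_of_le hcb, ← integral_Icc_eq_integral_Ioc,
    ← integral_Icc_eq_integral_Ioc, ← MeasureTheory.integral_indicator measurableSet_Icc,
    ← MeasureTheory.integral_indicator measurableSet_Icc]
  congr 1
  ext u
  simp only [Set.indicator_apply, Set.mem_Icc, mul_ite, mul_one, mul_zero]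
  by_cases h : c ≤ u
  · simp [h, hac.trans h]
  · simp [h]

/-- Abel summation with an arbitrary finite family of coefficients. -/
lemma integral_deriv_mul_sum_Ioc {a b : ℝ} (hab : a ≤ b) (χ : ℤ → ℂ) {f f' : ℝ → ℂ}
    (hf : ContinuousOn f (Set.Icc a b)) (hf' : ContinuousOn f' (Set.Icc a b))
    (hd : ∀ x ∈ Set.Ioo a b, HasDerivAt f (f' x) x) :
    IntervalIntegrable (fun u => f' u * ∑ n ∈ Finset.Ioc ⌊a⌋ ⌊u⌋, χ n) volume a b ∧
    ∫ u in a..b, f' u * ∑ n ∈ Finset.Ioc ⌊a⌋ ⌊u⌋, χ n =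
      (∑ n ∈ Finset.Ioc ⌊a⌋ ⌊b⌋, χ n) * f b - ∑ n ∈ Finset.Ioc ⌊a⌋ ⌊b⌋, χ n * f n := by
  have hint : IntervalIntegrable f' volume a b := by
    apply ContinuousOn.intervalIntegrable
    rwa [Set.uIcc_of_le hab]
  have hint' : ∀ n ∈ Finset.Ioc ⌊a⌋ ⌊b⌋, IntervalIntegrable
      (fun u => χ n * (f' u * (if (n : ℝ) ≤ u then 1 else 0))) volume a b := by
    intro n _
    refine IntervalIntegrable.const_mul ?_ _
    rw [intervalIntegrable_iff] at hint ⊢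
    refine (hint.indicator (measurableSet_Ici (a := (n : ℝ)))).congr ?_
    refine Eventually.of_forall fun u => ?_
    simp [Set.indicator_apply]
  have hcongr : Set.EqOn (fun u => ∑ n ∈ Finset.Ioc ⌊a⌋ ⌊b⌋,
      χ n * (f' u * (if (n : ℝ) ≤ u then 1 else 0)))
      (fun u => f' u * ∑ n ∈ Finset.Ioc ⌊a⌋ ⌊u⌋, χ n) (Set.uIcc a b) := by
    intro u hu
    rw [Set.uIcc_of_le hab] at hu
    have : Finset.Ioc ⌊a⌋ ⌊u⌋ = (Finset.Ioc ⌊a⌋ ⌊b⌋).filter (fun n : ℤ => (n : ℝ) ≤ u) := by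
      ext n
      simp only [Finset.mem_Ioc, Finset.mem_filter, Int.le_floor]
      exact ⟨fun h => ⟨⟨h.1, h.2.trans hu.2⟩, h.2⟩, fun h => ⟨h.1.1, h.2⟩⟩
    simp only [this, Finset.mul_sum, Finset.sum_filter]
    refine Finset.sum_congr rfl fun n _ => ?_
    split_ifs <;> ring
  constructor
  · exact (IntervalIntegrable.sum _ hint').congr (fun u hu => by
      simpa using hcongr (Set.uIoc_subset_uIcc hu))
  · rw [← integral_congr hcongr, integral_finsetSum hint', Finset.sum_mul,
      ← Finset.sum_sub_distrib]
    refine Finset.sum_congr rfl fun n hn => ?_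
    rw [Finset.mem_Ioc, Int.floor_lt, Int.le_floor] at hn
    have hsub : Set.Icc (n : ℝ) b ⊆ Set.Icc a b := Set.Icc_subset_Icc_left hn.1.le
    rw [intervalIntegral.integral_const_mul, integral_mul_ite_le hn.1.le hn.2,
      integral_eq_sub_of_hasDerivAt_of_le hn.2 (hf.mono hsub)
        (fun x hx => hd x ⟨hn.1.trans hx.1, hx.2⟩)
        ((hf'.mono hsub).intervalIntegrable_of_Icc hn.2), mul_sub]

lemma sum_mul_eq_integral_periodicSaw {k : ℕ} (hk : 1 ≤ k) {χ : ℤ → ℂ}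
    (hχ : ∀ n : ℤ, χ (n + (k : ℤ)) = χ n) {a b : ℝ} (hab : a ≤ b) {f f' : ℝ → ℂ}
    (hf : ContinuousOn f (Set.Icc a b)) (hf' : ContinuousOn f' (Set.Icc a b))
    (hd : ∀ x ∈ Set.Ioo a b, HasDerivAt f (f' x) x) :
    ∑ n ∈ Finset.Ioc ⌊a⌋ ⌊b⌋, χ n * f n =
      (1 / (k : ℂ)) * (∑ l ∈ Finset.Icc (1 : ℤ) (k : ℤ), χ l) * (∫ u in a..b, f u) +
        (f b * periodicSaw k χ b - f a * periodicSaw k χ a) -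
          ∫ u in a..b, f' u * periodicSaw k χ u := by
  obtain ⟨hi, hI⟩ := integral_deriv_mul_sum_Ioc hab χ hf hf' hd
  set M := (1 / (k : ℂ)) * ∑ l ∈ Finset.Icc (1 : ℤ) (k : ℤ), χ l with hM
  have hint : IntervalIntegrable f' volume a b := hf'.intervalIntegrable_of_Icc hab
  have hFTC : ∫ u in a..b, f' u = f b - f a :=
    integral_eq_sub_of_hasDerivAt_of_le hab hf hd hint
  have hid : ∀ u : ℝ, HasDerivAt (fun u : ℝ => (u : ℂ)) 1 u := fun u =>
    (hasDerivAt_id u).ofReal_comp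
  have hparts : ∫ u in a..b, f' u * (u : ℂ) = f b * b - f a * a - ∫ u in a..b, f u := by
    have h := integral_mul_deriv_eq_deriv_mul_of_hasDeriv_right (a := a) (b := b)
      (u := fun u : ℝ => (u : ℂ)) (u' := fun _ => 1) (v := f) (v' := f')
      (by fun_prop) (by rwa [Set.uIcc_of_le hab]) (fun x _ => (hid x).hasDerivWithinAt)
      (fun x hx => (hd x (by simpa [hab] using hx)).hasDerivWithinAt)
      intervalIntegrable_const hint
    simp only [one_mul] at h
    simp_rw [mul_comm (f' _), h]
    ring
  have hiu : IntervalIntegrable (fun u => f' u * (u : ℂ)) volume a b :=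
    (hf'.mul (by fun_prop)).intervalIntegrable_of_Icc hab
  have hsaw : ∫ u in a..b, f' u * periodicSaw k χ u =
      ∫ u in a..b, (f' u * ∑ n ∈ Finset.Ioc ⌊a⌋ ⌊u⌋, χ n) +
        f' u * (periodicSaw k χ a + M * a) - M * (f' u * u) := by
    refine integral_congr fun u hu => ?_
    rw [Set.uIcc_of_le hab] at hu
    simp only [sum_Ioc_eq_periodicSaw hk hχ hu.1, ← hM]
    ring
  rw [hsaw, integral_sub (hi.add (hint.mul_const _)) (hiu.const_mul _),
    integral_add hi (hint.mul_const _), hI, intervalIntegral.integral_mul_const,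
    intervalIntegral.integral_const_mul, hFTC, hparts, sum_Ioc_eq_periodicSaw hk hχ hab, ← hM]
  ring

lemma symTendsto_integral_mul_periodicSaw {k : ℕ} (hk : 1 ≤ k) (χ : ℤ → ℂ)
    {a b : ℝ} (hab : a ≤ b)
    {g : ℝ → ℂ} (hg : ContinuousOn g (Set.Icc a b)) :
    SymTendsto (fun n => tauSum k χ (-n) / twoPiI n *
        ∫ u in a..b, g u * ee ((n : ℂ) * (u : ℂ) / (k : ℂ)))
      (∫ u in a..b, g u * periodicSaw k χ u) := by
  have hint : IntervalIntegrable g volume a b := hg.intervalIntegrable_of_Icc hab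
  have hee : ∀ n : ℤ, Continuous fun u : ℝ => ee ((n : ℂ) * (u : ℂ) / (k : ℂ)) := by
    intro n
    unfold ee
    fun_prop
  have hsum : ∀ N : ℕ, ∑ n ∈ (Finset.Icc (-(N : ℤ)) (N : ℤ)).erase 0,
      tauSum k χ (-n) / twoPiI n * ∫ u in a..b, g u * ee ((n : ℂ) * (u : ℂ) / (k : ℂ)) =
      ∫ u in a..b, g u * periodicSawSum k χ N u := by
    intro N
    have hi : ∀ n ∈ (Finset.Icc (-(N : ℤ)) (N : ℤ)).erase 0, IntervalIntegrable
        (fun u => tauSum k χ (-n) / twoPiI n * (g u * ee ((n : ℂ) * (u : ℂ) / (k : ℂ))))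
        volume a b := fun n _ =>
      ((hg.mul (hee n).continuousOn).intervalIntegrable_of_Icc hab).const_mul _
    simp_rw [← intervalIntegral.integral_const_mul]
    rw [← integral_finsetSum hi]
    refine integral_congr fun u _ => ?_
    simp only [← sum_tauSum_mul_ee_div, Finset.mul_sum]
    refine Finset.sum_congr rfl fun n _ => ?_
    ring
  simp only [SymTendsto, hsum]
  refine intervalIntegral.tendsto_integral_filter_of_dominated_convergence
    (fun u => ‖g u‖ * ∑ l ∈ Finset.Icc (1 : ℤ) (k : ℤ), ‖χ l‖ * 2) ?_ ?_ ?_ ?_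
  · refine Eventually.of_forall fun N => ?_
    exact hint.def'.aestronglyMeasurable.mul (continuous_periodicSawSum k χ N).aestronglyMeasurable
  · refine Eventually.of_forall fun N => Eventually.of_forall fun u _ => ?_
    rw [norm_mul]
    gcongr
    exact norm_periodicSawSum_le k χ N u
  · exact hint.norm.mul_const _
  · have hnull : ∀ᵐ u : ℝ, u ∉ Set.range ((↑) : ℤ → ℝ) :=
      (Set.countable_range _).ae_notMem volume
    filter_upwards [hnull] with u hu _
    exact (tendsto_periodicSawSum hk χ fun n h => hu ⟨n, h.symm⟩).const_mul _

lemma integral_deriv_mul_ee (k : ℕ) (n : ℤ) {a b : ℝ} (hab : a ≤ b)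
    {f f' : ℝ → ℂ}
    (hf : ContinuousOn f (Set.Icc a b)) (hf' : ContinuousOn f' (Set.Icc a b))
    (hd : ∀ x ∈ Set.Ioo a b, HasDerivAt f (f' x) x) :
    ∫ u in a..b, f' u * ee ((n : ℂ) * (u : ℂ) / (k : ℂ)) =
      f b * ee ((n : ℂ) * (b : ℂ) / (k : ℂ)) - f a * ee ((n : ℂ) * (a : ℂ) / (k : ℂ)) -
        twoPiI n / k * ∫ u in a..b, f u * ee ((n : ℂ) * (u : ℂ) / (k : ℂ)) := by
  have hee : ∀ u : ℝ, HasDerivAt (fun u : ℝ => ee ((n : ℂ) * (u : ℂ) / (k : ℂ)))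
      (twoPiI n / k * ee ((n : ℂ) * (u : ℂ) / (k : ℂ))) u := by
    intro u
    have h := ((((hasDerivAt_id u).ofReal_comp.const_mul (n : ℂ)).div_const (k : ℂ)).const_mul
      (2 * (Real.pi : ℂ) * Complex.I)).cexp
    refine h.congr_deriv ?_
    simp only [ee, twoPiI, id]
    push_cast
    ring
  have hcont : Continuous fun u : ℝ => ee ((n : ℂ) * (u : ℂ) / (k : ℂ)) :=
    continuous_iff_continuousAt.2 fun u => (hee u).continuousAt
  have h := integral_mul_deriv_eq_deriv_mul_of_hasDeriv_right (a := a) (b := b)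
    (u := fun u : ℝ => ee ((n : ℂ) * (u : ℂ) / (k : ℂ)))
    (u' := fun u : ℝ => twoPiI n / k * ee ((n : ℂ) * (u : ℂ) / (k : ℂ))) (v := f) (v' := f')
    hcont.continuousOn (by rwa [Set.uIcc_of_le hab]) (fun x _ => (hee x).hasDerivWithinAt)
    (fun x hx => (hd x (by simpa [hab] using hx)).hasDerivWithinAt)
    ((hcont.const_mul _).intervalIntegrable _ _) (hf'.intervalIntegrable_of_Icc hab)
  simp_rw [mul_comm (f' _), h, mul_assoc, intervalIntegral.integral_const_mul, mul_comm (f _)]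

/-- The expansion for a function given together with its successive derivatives `F r`. -/
lemma exists_symTendsto_and_sum_eq {k : ℕ} (hk : 1 ≤ k) {χ : ℤ → ℂ}
    (hχ : ∀ n : ℤ, χ (n + (k : ℤ)) = χ n) {a b : ℝ} (hab : a ≤ b) {Ta Tb : ℕ → ℂ}
    (hTa0 : Ta 0 = periodicSaw k χ a) (hTb0 : Tb 0 = periodicSaw k χ b)
    (hTa : ∀ r, SymTendsto (fun n => tauSum k χ (-n) * ee ((n : ℂ) * (a : ℂ) / (k : ℂ)) /
      (twoPiI n) ^ (r + 1)) (Ta r))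
    (hTb : ∀ r, SymTendsto (fun n => tauSum k χ (-n) * ee ((n : ℂ) * (b : ℂ) / (k : ℂ)) /
      (twoPiI n) ^ (r + 1)) (Tb r))
    (F : ℕ → ℝ → ℂ) (R : ℕ) (hF : ∀ r ≤ R + 1, ContinuousOn (F r) (Set.Icc a b))
    (hd : ∀ r ≤ R, ∀ x ∈ Set.Ioo a b, HasDerivAt (F r) (F (r + 1) x) x) :
    ∃ J : ℂ, SymTendsto (fun n => tauSum k χ (-n) / (twoPiI n) ^ (R + 1) *
        ∫ u in a..b, F (R + 1) u * ee ((n : ℂ) * (u : ℂ) / (k : ℂ))) J ∧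
      ∑ n ∈ Finset.Ioc ⌊a⌋ ⌊b⌋, χ n * F 0 n =
        (1 / (k : ℂ)) * (∑ l ∈ Finset.Icc (1 : ℤ) (k : ℤ), χ l) * (∫ u in a..b, F 0 u) +
          (∑ r ∈ Finset.range (R + 1), (-(k : ℂ)) ^ r * (F r b * Tb r - F r a * Ta r)) -
            (-(k : ℂ)) ^ R * J := by
  induction R with
  | zero =>
    refine ⟨∫ u in a..b, F 1 u * periodicSaw k χ u, ?_, ?_⟩
    · simpa using symTendsto_integral_mul_periodicSaw hk χ hab (hF 1 le_rfl)
    · rw [sum_mul_eq_integral_periodicSaw hk hχ hab (hF 0 (by omega)) (hF 1 le_rfl) (hd 0 le_rfl)]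
      simp [hTa0, hTb0]
  | succ R ih =>
    obtain ⟨J, hJ, hsum⟩ := ih (fun r hr => hF r (by omega)) (fun r hr => hd r (by omega))
    have hk0 : (k : ℂ) ≠ 0 := by exact_mod_cast (by omega : k ≠ 0)
    refine ⟨F (R + 1) b * Tb (R + 1) - F (R + 1) a * Ta (R + 1) - 1 / k * J, ?_, ?_⟩
    · have h := (((hTb (R + 1)).const_mul (F (R + 1) b)).sub
        ((hTa (R + 1)).const_mul (F (R + 1) a))).sub (hJ.const_mul (1 / (k : ℂ)))
      refine h.congr fun N => ?_
      simp only [Finset.mul_sum, ← Finset.sum_sub_distrib]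
      refine Finset.sum_congr rfl fun n hn => ?_
      have hn0 := twoPiI_ne_zero (Finset.ne_of_mem_erase hn)
      rw [integral_deriv_mul_ee k n hab (hF (R + 1) (by omega)) (hF (R + 2) le_rfl)
        (hd (R + 1) le_rfl)]
      field_simp
      ring
    · rw [hsum, Finset.sum_range_succ _ (R + 1)]
      field_simp
      ring

/-- Euler–Maclaurin analogue for a periodic weight (Theorem 1(I)). -/
theorem euler_maclaurin_periodic_weight
    (k : ℕ) (hk : 1 ≤ k) (χ : ℤ → ℂ) (hχ : ∀ n : ℤ, χ (n + (k : ℤ)) = χ n)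
    (R : ℕ) (a b : ℝ) (hab : a < b)
    (ha : ∀ n : ℤ, a ≠ (n : ℝ)) (hb : ∀ n : ℤ, b ≠ (n : ℝ))
    (f : ℝ → ℂ) (hf : ContDiffOn ℝ (R + 1) f (Set.Icc a b)) :
    ∃ Tb Ta : ℕ → ℂ, ∃ J : ℂ,
      (∀ r, r ≤ R → SymTendsto
        (fun n => tauSum k χ (-n) * ee ((n : ℂ) * (b : ℂ) / (k : ℂ)) / (twoPiI n) ^ (r + 1))
        (Tb r)) ∧
      (∀ r, r ≤ R → SymTendsto
        (fun n => tauSum k χ (-n) * ee ((n : ℂ) * (a : ℂ) / (k : ℂ)) / (twoPiI n) ^ (r + 1))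
        (Ta r)) ∧
      SymTendsto
        (fun n => tauSum k χ (-n) / (twoPiI n) ^ (R + 1) *
          ∫ u in a..b, iteratedDerivWithin (R + 1) f (Set.Icc a b) u *
            ee ((n : ℂ) * (u : ℂ) / (k : ℂ)))
        J ∧
      ∑ n ∈ Finset.Ioc ⌊a⌋ ⌊b⌋, χ n * f (n : ℝ)
        = (1 / (k : ℂ)) * (∑ l ∈ Finset.Icc (1 : ℤ) (k : ℤ), χ l) * (∫ u in a..b, f u)
          + (∑ r ∈ Finset.range (R + 1), (-(k : ℂ)) ^ r *
              (iteratedDerivWithin r f (Set.Icc a b) b * Tb r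
                - iteratedDerivWithin r f (Set.Icc a b) a * Ta r))
          - (-(k : ℂ)) ^ R * J := by
  have hu : UniqueDiffOn ℝ (Set.Icc a b) := uniqueDiffOn_Icc hab
  obtain ⟨Tb, hTb0, hTb⟩ := exists_symTendsto_tauSum hk χ hb
  obtain ⟨Ta, hTa0, hTa⟩ := exists_symTendsto_tauSum hk χ ha
  obtain ⟨J, hJ, hsum⟩ := exists_symTendsto_and_sum_eq hk hχ hab.le hTa0 hTb0 hTa hTb
    (fun r => iteratedDerivWithin r f (Set.Icc a b)) R
    (fun r hr => hf.continuousOn_iteratedDerivWithin (by exact_mod_cast hr) hu)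
    (fun r hr x hx => by
      have hmem := Icc_mem_nhds hx.1 hx.2
      have hdiff := hf.differentiableOn_iteratedDerivWithin (m := r)
        (by exact_mod_cast Nat.lt_succ_of_le hr) hu x (Set.Ioo_subset_Icc_self hx)
      rw [iteratedDerivWithin_succ]
      exact hdiff.hasDerivWithinAt.hasDerivAt hmem)
  simp only [iteratedDerivWithin_zero] at hsum
  exact ⟨Tb, Ta, J, fun r _ => hTb r, fun r _ => hTa r, hJ, hsum⟩
end

section
/- Poisson analogue for the divisor function (Theorem 2(II)): Let a, b be real numbers with 0 ≤ a < b and a, b ∉ ℤ, and let f : ℝ → ℂ be continuously differentiable on [a,b]. Then the symmetric partial sums Σ_{|n| ≤ N} ∫_a^b f(u) ( Σ_{1 ≤ m ≤ b} (1/m) e^{2πinu/m} ) du converge as N → ∞ to Σ_{a < n ≤ b} d(n) f(n); that is, Σ_{a < n ≤ b} d(n) f(n) = Σ_{n=−∞}^{∞} ∫_a^b f(u) ( Σ_{1 ≤ m ≤ b} (1/m) e^{2πinu/m} ) du. -/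
open MeasureTheory intervalIntegral Filter

lemma ee_eq_fourierChar (x : ℝ) : ee (x : ℂ) = (Real.fourierChar x : ℂ) := by
  rw [ee, Real.fourierChar_apply]
  push_cast
  ring_nf

lemma ee_intCast (n : ℤ) : ee (n : ℂ) = 1 := by
  rw [ee, mul_comm]
  exact Complex.exp_int_mul_two_pi_mul_I n

@[fun_prop]
lemma continuous_ee : Continuous ee := by
  unfold ee
  fun_prop

lemma four_mul_abs_le_norm_ee_sub_one {v : ℝ} (hv : |v| ≤ 1 / 2) :
    4 * |v| ≤ ‖ee (v : ℂ) - 1‖ := by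
  have h : ee (v : ℂ) = Complex.exp (Complex.I * ((2 * Real.pi * v : ℝ) : ℂ)) := by
    rw [ee]
    push_cast
    ring_nf
  have h1 : |Real.pi * v| ≤ Real.pi / 2 := by
    rw [abs_mul, abs_of_pos Real.pi_pos]
    nlinarith [Real.pi_pos]
  have h2 := Real.mul_abs_le_abs_sin h1
  rw [h, Complex.norm_exp_I_mul_ofReal_sub_one, Real.norm_eq_abs, abs_mul,
    show 2 * Real.pi * v / 2 = Real.pi * v by ring, abs_two]
  rw [abs_mul, abs_of_pos Real.pi_pos, ← mul_assoc, div_mul_cancel₀ _ Real.pi_ne_zero] at h2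
  linarith

/-- The Riemann-Lebesgue lemma on a bounded interval. -/
lemma tendsto_integral_mul_ee_cocompact (K : ℝ → ℂ) {a b : ℝ} (hab : a ≤ b) :
    Tendsto (fun w : ℝ => ∫ v in a..b, K v * ee ((w : ℂ) * (v : ℂ))) (cocompact ℝ) (nhds 0) := by
  have h := (Real.tendsto_integral_exp_smul_cocompact ((Set.Ioc a b).indicator K)).comp
    (Homeomorph.neg ℝ).isClosedEmbedding.tendsto_cocompact
  refine h.congr fun w => ?_
  rw [intervalIntegral.integral_of_le hab, ← MeasureTheory.integral_indicator measurableSet_Ioc]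
  refine integral_congr_ae (Eventually.of_forall fun v => ?_)
  by_cases hv : v ∈ Set.Ioc a b
  · simp only [Set.indicator_of_mem hv, Circle.smul_def, smul_eq_mul, ← ee_eq_fourierChar,
      Homeomorph.coe_neg]
    push_cast
    ring_nf
  · simp [Set.indicator_of_notMem hv]

lemma integral_ee_intCast_mul (n : ℤ) :
    ∫ v in (-(1 / 2) : ℝ)..(1 / 2), ee ((n : ℂ) * (v : ℂ)) = if n = 0 then 1 else 0 := by
  split_ifs with hn
  · norm_num [hn, ee]
  · have hc : 2 * (Real.pi : ℂ) * Complex.I * n ≠ 0 := by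
      simp [hn, Real.pi_ne_zero]
    have h := integral_exp_mul_complex (a := -(1 / 2)) (b := 1 / 2) hc
    simp only [ee, ← mul_assoc]
    rw [h, div_eq_zero_iff, sub_eq_zero]
    left
    rw [Complex.exp_eq_exp_iff_exists_int]
    refine ⟨n, ?_⟩
    push_cast
    ring

lemma sum_Icc_neg_intCast_sub (c : ℤ → ℂ) (N : ℕ) :
    ∑ n ∈ Finset.Icc (-(N : ℤ)) N, (c (n + 1) - c n) = c (N + 1) - c (-N) := by
  induction N with
  | zero => simp
  | succ N ih =>
    have h : Finset.Icc (-((N + 1 : ℕ) : ℤ)) ((N + 1 : ℕ) : ℤ) =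
        insert (-(N : ℤ) - 1) (insert ((N : ℤ) + 1) (Finset.Icc (-(N : ℤ)) N)) := by
      ext x
      simp only [Finset.mem_Icc, Finset.mem_insert]
      omega
    rw [h, Finset.sum_insert (by simp; omega), Finset.sum_insert (by simp), ih]
    push_cast
    rw [show -(N : ℤ) - 1 + 1 = -N by ring, show -((N : ℤ) + 1) = -N - 1 by ring]
    ring

/-- The symmetric partial sums of the Fourier series at `0` of a function converge to its value
if the function has a linear modulus of continuity there. -/
lemma tendsto_sum_integral_mul_ee_of_norm_sub_le {H : ℝ → ℂ} (hH : AEStronglyMeasurable H)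
    {C : ℝ} (hC : ∀ v, ‖H v - H 0‖ ≤ C * |v|) :
    Tendsto (fun N : ℕ => ∑ n ∈ Finset.Icc (-(N : ℤ)) N,
      ∫ v in (-(1 / 2) : ℝ)..(1 / 2), H v * ee ((n : ℂ) * (v : ℂ))) atTop (nhds (H 0)) := by
  set K : ℝ → ℂ := fun v => (H v - H 0) / (ee (v : ℂ) - 1) with hK
  have hle : (-(1 / 2) : ℝ) ≤ 1 / 2 := by norm_num
  have hC0 : 0 ≤ C := by simpa using (norm_nonneg _).trans (hC 1)
  have hKm : AEStronglyMeasurable K := by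
    have h1 : AEStronglyMeasurable (fun v : ℝ => ee (v : ℂ) - 1) :=
      (by fun_prop : Continuous fun v : ℝ => ee (v : ℂ) - 1).aestronglyMeasurable
    exact ((hH.aemeasurable.sub_const _).div h1.aemeasurable).aestronglyMeasurable
  have hmem : ∀ v ∈ Set.uIoc (-(1 / 2) : ℝ) (1 / 2), |v| ≤ 1 / 2 := by
    intro v hv
    rw [Set.uIoc_of_le hle] at hv
    exact abs_le.2 ⟨hv.1.le, hv.2⟩
  have hKb : ∀ v ∈ Set.uIoc (-(1 / 2) : ℝ) (1 / 2), ‖K v‖ ≤ C := by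
    intro v hv
    have h1 := four_mul_abs_le_norm_ee_sub_one (hmem v hv)
    rw [hK, norm_div]
    refine div_le_of_le_mul₀ (norm_nonneg _) hC0 ((hC v).trans ?_)
    gcongr
    linarith [abs_nonneg v]
  have hKi : ∀ n : ℤ, IntervalIntegrable (fun v => K v * ee ((n : ℂ) * (v : ℂ))) volume
      (-(1 / 2)) (1 / 2) := by
    intro n
    refine IntervalIntegrable.mul_continuousOn ?_ (by fun_prop)
    refine (intervalIntegrable_const (c := C)).mono_fun hKm.restrict ?_
    refine (ae_restrict_iff' measurableSet_uIoc).2 (Eventually.of_forall fun v hv => ?_)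
    simpa [abs_of_nonneg hC0] using hKb v hv
  have hHK : ∀ v ∈ Set.uIoc (-(1 / 2) : ℝ) (1 / 2), H v = H 0 + (ee (v : ℂ) - 1) * K v := by
    intro v hv
    rcases eq_or_ne v 0 with rfl | h0
    · simp [hK]
    · have h1 := four_mul_abs_le_norm_ee_sub_one (hmem v hv)
      have h2 : ee (v : ℂ) - 1 ≠ 0 := norm_pos_iff.1 (by linarith [abs_pos.2 h0])
      rw [hK]
      field_simp
      ring
  set c : ℤ → ℂ := fun n => ∫ v in (-(1 / 2) : ℝ)..(1 / 2), K v * ee ((n : ℂ) * (v : ℂ)) with hc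
  have hterm : ∀ n : ℤ, ∫ v in (-(1 / 2) : ℝ)..(1 / 2), H v * ee ((n : ℂ) * (v : ℂ)) =
      (if n = 0 then H 0 else 0) + (c (n + 1) - c n) := by
    intro n
    have h1 : ∫ v in (-(1 / 2) : ℝ)..(1 / 2), H v * ee ((n : ℂ) * (v : ℂ)) =
        ∫ v in (-(1 / 2) : ℝ)..(1 / 2), (H 0 * ee ((n : ℂ) * (v : ℂ)) +
          (K v * ee (((n + 1 : ℤ) : ℂ) * (v : ℂ)) - K v * ee ((n : ℂ) * (v : ℂ)))) := by
      refine intervalIntegral.integral_congr_ae (Eventually.of_forall fun v hv => ?_)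
      rw [hHK v hv]
      push_cast
      rw [add_mul (n : ℂ), one_mul, ee_add]
      ring
    rw [h1, intervalIntegral.integral_add
      (Continuous.intervalIntegrable (by fun_prop) _ _) ((hKi _).sub (hKi _)),
      intervalIntegral.integral_sub (hKi _) (hKi _), intervalIntegral.integral_const_mul,
      integral_ee_intCast_mul]
    simp [hc]
  have hsum : ∀ N : ℕ, ∑ n ∈ Finset.Icc (-(N : ℤ)) N,
      ∫ v in (-(1 / 2) : ℝ)..(1 / 2), H v * ee ((n : ℂ) * (v : ℂ)) =
        H 0 + (c (N + 1) - c (-N)) := by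
    intro N
    rw [Finset.sum_congr rfl fun n _ => hterm n, Finset.sum_add_distrib, sum_Icc_neg_intCast_sub]
    simp
  simp_rw [hsum]
  have hRL := tendsto_integral_mul_ee_cocompact K hle
  have ht1 : Tendsto (fun N : ℕ => c (N + 1)) atTop (nhds 0) := by
    refine (hRL.comp (atTop_le_cocompact.trans' (tendsto_atTop_add_const_right atTop (1 : ℝ)
      tendsto_natCast_atTop_atTop))).congr fun N => ?_
    simp [hc]
  have ht2 : Tendsto (fun N : ℕ => c (-N)) atTop (nhds 0) := by
    refine (hRL.comp (atBot_le_cocompact.trans' (tendsto_neg_atTop_atBot.comp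
      (tendsto_natCast_atTop_atTop (R := ℝ))))).congr fun N => ?_
    simp [hc]
  simpa using (ht1.sub ht2).const_add (H 0)

lemma DifferentiableAt.exists_norm_sub_le_mul_abs {H : ℝ → ℂ} (hd : DifferentiableAt ℝ H 0)
    {M : ℝ} (hM : ∀ v, ‖H v‖ ≤ M) : ∃ C, ∀ v, ‖H v - H 0‖ ≤ C * |v| := by
  obtain ⟨c, hc⟩ := hd.isBigO_sub.bound
  obtain ⟨δ, hδ, hball⟩ := Metric.eventually_nhds_iff.1 hc
  have hM0 : 0 ≤ M := (norm_nonneg _).trans (hM 0)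
  refine ⟨max c (2 * M / δ), fun v => ?_⟩
  rcases lt_or_ge |v| δ with h | h
  · have h1 := hball (y := v) (by simpa using h)
    simp only [sub_zero, Real.norm_eq_abs] at h1
    exact h1.trans (by gcongr; exact le_max_left _ _)
  · calc ‖H v - H 0‖ ≤ 2 * M := by linarith [norm_sub_le (H v) (H 0), hM v, hM 0]
      _ = 2 * M / δ * δ := by field_simp
      _ ≤ max c (2 * M / δ) * |v| := by
        gcongr
        exact le_max_right _ _

lemma DifferentiableAt.indicator_of_ne {g : ℝ → ℂ} {α β x : ℝ}
    (hd : ∀ y ∈ Set.Ioo α β, DifferentiableAt ℝ g y) (hα : x ≠ α) (hβ : x ≠ β) :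
    DifferentiableAt ℝ ((Set.Ioc α β).indicator g) x := by
  by_cases hx : x ∈ Set.Ioo α β
  · refine (hd x hx).congr_of_eventuallyEq ?_
    filter_upwards [isOpen_Ioo.mem_nhds hx] with y hy
    exact Set.indicator_of_mem (Set.Ioo_subset_Ioc_self hy) g
  · have hx' : x ∈ (Set.Icc α β)ᶜ := fun h =>
      hx ⟨lt_of_le_of_ne h.1 hα.symm, lt_of_le_of_ne h.2 hβ⟩
    refine (differentiableAt_const (0 : ℂ)).congr_of_eventuallyEq ?_
    filter_upwards [isClosed_Icc.isOpen_compl.mem_nhds hx'] with y hy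
    exact Set.indicator_of_notMem (fun h => hy (Set.Ioc_subset_Icc_self h)) g

lemma ContinuousOn.exists_norm_indicator_le {g : ℝ → ℂ} {α β : ℝ}
    (hc : ContinuousOn g (Set.Icc α β)) : ∃ M, ∀ x, ‖(Set.Ioc α β).indicator g x‖ ≤ M := by
  obtain ⟨M, hM⟩ := isCompact_Icc.exists_bound_of_continuousOn hc
  refine ⟨max M 0, fun x => ?_⟩
  by_cases hx : x ∈ Set.Ioc α β
  · rw [Set.indicator_of_mem hx]
    exact (hM x (Set.Ioc_subset_Icc_self hx)).trans (le_max_left _ _)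
  · simp [Set.indicator_of_notMem hx]

lemma ContinuousOn.aestronglyMeasurable_indicator_Ioc {g : ℝ → ℂ} {α β : ℝ}
    (hc : ContinuousOn g (Set.Icc α β)) :
    AEStronglyMeasurable ((Set.Ioc α β).indicator g) :=
  (aestronglyMeasurable_indicator_iff measurableSet_Ioc).2
    ((hc.mono Set.Ioc_subset_Icc_self).aestronglyMeasurable measurableSet_Ioc)

lemma integral_mul_ee_eq_sum {g : ℝ → ℂ} {α β : ℝ} (hαβ : α ≤ β)
    (hc : ContinuousOn g (Set.Icc α β)) (n : ℤ) :
    ∫ v in α..β, g v * ee ((n : ℂ) * (v : ℂ)) =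
      ∑ k ∈ Finset.range (⌊β⌋ - ⌊α⌋ + 2).toNat, ∫ v in (-(1 / 2) : ℝ)..(1 / 2),
        (Set.Ioc α β).indicator g (v + (⌊α⌋ + k : ℤ)) * ee ((n : ℂ) * (v : ℂ)) := by
  set G := (Set.Ioc α β).indicator g
  set L := (⌊β⌋ - ⌊α⌋ + 2).toNat with hL
  have hLcast : (L : ℝ) = ⌊β⌋ - ⌊α⌋ + 2 := by
    have h := Int.floor_le_floor hαβ
    have h1 : (L : ℤ) = ⌊β⌋ - ⌊α⌋ + 2 := Int.toNat_of_nonneg (by omega)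
    exact_mod_cast h1
  have hshift : ∀ k : ℕ, ∫ v in (-(1 / 2) : ℝ)..(1 / 2),
      G (v + (⌊α⌋ + k : ℤ)) * ee ((n : ℂ) * (v : ℂ)) =
        ∫ v in (⌊α⌋ - 1 / 2 + (k : ℕ) : ℝ)..(⌊α⌋ - 1 / 2 + (k + 1 : ℕ)),
          G v * ee ((n : ℂ) * (v : ℂ)) := by
    intro k
    have h := intervalIntegral.integral_comp_add_right (a := -(1 / 2)) (b := 1 / 2)
      (fun v : ℝ => G v * ee ((n : ℂ) * (v : ℂ))) ((⌊α⌋ + k : ℤ) : ℝ)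
    convert! h using 1
    · refine intervalIntegral.integral_congr fun v _ => ?_
      simp only [Complex.ofReal_add, mul_add, ee_add]
      rw [Complex.ofReal_intCast, ← Int.cast_mul, ee_intCast, mul_one]
    · push_cast
      congr 1 <;> ring
  have hint : Integrable (fun v => G v * ee ((n : ℂ) * (v : ℂ))) := by
    have hgi : IntegrableOn (fun v => g v * ee ((n : ℂ) * (v : ℂ))) (Set.Ioc α β) :=
      ((hc.mul (by fun_prop)).integrableOn_compact isCompact_Icc).mono_set
        Set.Ioc_subset_Icc_self
    refine (hgi.integrable_indicator measurableSet_Ioc).congr (Eventually.of_forall fun v => ?_)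
    exact Set.indicator_mul_left _ _ _
  simp_rw [hshift]
  rw [intervalIntegral.sum_integral_adjacent_intervals
    (a := fun k : ℕ => (⌊α⌋ - 1 / 2 + k : ℝ)) fun k _ => hint.intervalIntegrable,
    intervalIntegral.integral_of_le hαβ, intervalIntegral.integral_of_le (by simp)]
  have hsub : Set.Ioc α β ⊆ Set.Ioc (⌊α⌋ - 1 / 2 + (0 : ℕ) : ℝ) (⌊α⌋ - 1 / 2 + (L : ℕ)) := by
    refine Set.Ioc_subset_Ioc ?_ ?_
    · push_cast
      linarith [Int.floor_le α]
    · linarith [Int.lt_floor_add_one β]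
  rw [← Set.inter_eq_right.2 hsub, ← setIntegral_indicator measurableSet_Ioc]
  refine integral_congr_ae (Eventually.of_forall fun v => ?_)
  exact Set.indicator_mul_left _ _ _

/-- Poisson summation on a bounded interval with non-integral endpoints. -/
theorem tendsto_sum_integral_mul_ee {g : ℝ → ℂ} {α β : ℝ} (hαβ : α ≤ β)
    (hα : ∀ n : ℤ, α ≠ n) (hβ : ∀ n : ℤ, β ≠ n) (hc : ContinuousOn g (Set.Icc α β))
    (hd : ∀ x ∈ Set.Ioo α β, DifferentiableAt ℝ g x) :
    Tendsto (fun N : ℕ => ∑ n ∈ Finset.Icc (-(N : ℤ)) N,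
      ∫ v in α..β, g v * ee ((n : ℂ) * (v : ℂ))) atTop
      (nhds (∑ k ∈ Finset.Ioc ⌊α⌋ ⌊β⌋, g k)) := by
  set G := (Set.Ioc α β).indicator g with hG
  have hfl := Int.floor_le_floor hαβ
  obtain ⟨M, hM⟩ := hc.exists_norm_indicator_le
  have hlocal : ∀ j : ℤ, Tendsto (fun N : ℕ => ∑ n ∈ Finset.Icc (-(N : ℤ)) N,
      ∫ v in (-(1 / 2) : ℝ)..(1 / 2), G (v + j) * ee ((n : ℂ) * (v : ℂ))) atTop
      (nhds (G j)) := by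
    intro j
    have hdj : DifferentiableAt ℝ (fun v => G (v + j)) 0 :=
      (differentiableAt_comp_add_const (f := G) (a := (0 : ℝ)) (b := (j : ℝ))).2 (by
        rw [zero_add]
        exact DifferentiableAt.indicator_of_ne hd (hα j).symm (hβ j).symm)
    obtain ⟨C, hC⟩ := hdj.exists_norm_sub_le_mul_abs fun v => hM (v + j)
    have hm : AEStronglyMeasurable (fun v => G (v + j)) :=
      hc.aestronglyMeasurable_indicator_Ioc.comp_measurePreserving
        (measurePreserving_add_right volume (j : ℝ))
    simpa using tendsto_sum_integral_mul_ee_of_norm_sub_le hm hC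
  have hlim : ∑ k ∈ Finset.Ioc ⌊α⌋ ⌊β⌋, g k =
      ∑ k ∈ Finset.range (⌊β⌋ - ⌊α⌋ + 2).toNat, G (⌊α⌋ + k : ℤ) := by
    have hmem : ∀ k : ℤ, k ∈ Finset.Ioc ⌊α⌋ ⌊β⌋ ↔ (k : ℝ) ∈ Set.Ioc α β := by
      intro k
      rw [Finset.mem_Ioc, Set.mem_Ioc, Int.floor_lt, Int.le_floor]
    symm
    refine Finset.sum_bij_ne_zero (fun k _ _ => ⌊α⌋ + k) ?_ ?_ ?_ ?_
    · intro k _ hk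
      exact (hmem _).2 (Set.mem_of_indicator_ne_zero hk)
    · intro k _ _ l _ _ h
      omega
    · intro j hj _
      have hj' := Finset.mem_Ioc.1 hj
      have hjk : ⌊α⌋ + ((j - ⌊α⌋).toNat : ℤ) = j := by omega
      refine ⟨(j - ⌊α⌋).toNat, Finset.mem_range.2 (by omega), ?_, hjk⟩
      rwa [hjk, hG, Set.indicator_of_mem ((hmem j).1 hj)]
    · intro k _ hk
      exact Set.indicator_of_mem (Set.mem_of_indicator_ne_zero hk) g
  rw [hlim]
  refine (tendsto_finsetSum _ fun (k : ℕ) _ => hlocal (⌊α⌋ + k)).congr fun N => ?_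
  rw [Finset.sum_comm]
  exact Finset.sum_congr rfl fun n _ => (integral_mul_ee_eq_sum hαβ hc n).symm

lemma integral_mul_inv_mul_ee_div (f : ℝ → ℂ) (a b : ℝ) {m : ℤ} (hm : m ≠ 0) (n : ℤ) :
    ∫ u in a..b, f u * ((1 / (m : ℂ)) * ee ((n : ℂ) * (u : ℂ) / (m : ℂ))) =
      ∫ v in a / m..b / m, f (m * v) * ee ((n : ℂ) * (v : ℂ)) := by
  have hm' : (m : ℝ) ≠ 0 := Int.cast_ne_zero.2 hm
  rw [← intervalIntegral.inv_smul_integral_comp_div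
    (fun v : ℝ => f (m * v) * ee ((n : ℂ) * (v : ℂ))) (m : ℝ),
    ← intervalIntegral.integral_smul]
  refine intervalIntegral.integral_congr fun u _ => ?_
  simp only [Complex.real_smul, mul_div_cancel₀ u hm']
  push_cast
  rw [mul_div_assoc]
  ring

lemma sum_Ioc_floor_div_eq_sum_filter (f : ℝ → ℂ) (a b : ℝ) {m : ℤ} (hm : 0 < m) :
    ∑ k ∈ Finset.Ioc ⌊a / m⌋ ⌊b / m⌋, f (m * k) =
      ∑ n ∈ Finset.Ioc ⌊a⌋ ⌊b⌋ with m ∣ n, f n := by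
  have hm' : (0 : ℝ) < m := Int.cast_pos.2 hm
  have hmem : ∀ k : ℤ, k ∈ Finset.Ioc ⌊a / m⌋ ⌊b / m⌋ ↔ m * k ∈ Finset.Ioc ⌊a⌋ ⌊b⌋ := by
    intro k
    simp only [Finset.mem_Ioc, Int.floor_lt, Int.le_floor, div_lt_iff₀ hm', le_div_iff₀ hm',
      Int.cast_mul, mul_comm (k : ℝ)]
  refine Finset.sum_bij (fun k _ => m * k) ?_ ?_ ?_ ?_
  · intro k hk
    exact Finset.mem_filter.2 ⟨(hmem k).1 hk, dvd_mul_right _ _⟩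
  · intro k _ l _ h
    exact mul_left_cancel₀ hm.ne' h
  · intro n hn
    obtain ⟨hn, k, rfl⟩ := Finset.mem_filter.1 hn
    exact ⟨k, (hmem k).2 hn, rfl⟩
  · intro k _
    push_cast
    rfl

lemma card_filter_dvd_Icc_eq_card_divisors {n B : ℤ} (hn : 0 < n) (hnB : n ≤ B) :
    (Finset.filter (· ∣ n) (Finset.Icc 1 B)).card = n.toNat.divisors.card := by
  have hcast : (n.toNat : ℤ) = n := Int.toNat_of_nonneg hn.le
  symm
  refine Finset.card_bij (fun d _ => (d : ℤ)) ?_ ?_ ?_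
  · intro d hd
    have hdvd : (d : ℤ) ∣ n := by
      rw [← hcast]
      exact_mod_cast Nat.dvd_of_mem_divisors hd
    have hle := Int.le_of_dvd hn hdvd
    have hpos := Nat.pos_of_mem_divisors hd
    exact Finset.mem_filter.2 ⟨Finset.mem_Icc.2 ⟨by omega, by omega⟩, hdvd⟩
  · intro d _ e _ h
    exact_mod_cast h
  · intro m hm
    obtain ⟨hm, hdvd⟩ := Finset.mem_filter.1 hm
    have hm1 := (Finset.mem_Icc.1 hm).1
    have hmc : (m.toNat : ℤ) = m := Int.toNat_of_nonneg (by omega)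
    refine ⟨m.toNat, Nat.mem_divisors.2 ⟨?_, by omega⟩, hmc⟩
    rw [← Int.natCast_dvd_natCast, hcast, hmc]
    exact hdvd

lemma sum_sum_Ioc_floor_div_eq_sum_card_divisors (f : ℝ → ℂ) {a b : ℝ} (ha : 0 ≤ a) :
    ∑ m ∈ Finset.Icc (1 : ℤ) ⌊b⌋, ∑ k ∈ Finset.Ioc ⌊a / m⌋ ⌊b / m⌋, f (m * k) =
      ∑ n ∈ Finset.Ioc ⌊a⌋ ⌊b⌋, (n.toNat.divisors.card : ℂ) * f n := by
  rw [Finset.sum_congr rfl fun m hm =>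
    sum_Ioc_floor_div_eq_sum_filter f a b (m := m) (by linarith [(Finset.mem_Icc.1 hm).1])]
  simp_rw [Finset.sum_filter]
  rw [Finset.sum_comm]
  refine Finset.sum_congr rfl fun n hn => ?_
  obtain ⟨h1, h2⟩ := Finset.mem_Ioc.1 hn
  rw [← Finset.sum_filter, Finset.sum_const, nsmul_eq_mul,
    card_filter_dvd_Icc_eq_card_divisors ((Int.floor_nonneg.2 ha).trans_lt h1) h2]

/-- Poisson analogue for the divisor function (Theorem 2(II)). -/
theorem poisson_divisor
    (a b : ℝ) (ha0 : 0 ≤ a) (hab : a < b)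
    (ha : ∀ n : ℤ, a ≠ (n : ℝ)) (hb : ∀ n : ℤ, b ≠ (n : ℝ))
    (f : ℝ → ℂ) (hf : ContDiffOn ℝ 1 f (Set.Icc a b)) :
    Tendsto
      (fun N : ℕ => ∑ n ∈ Finset.Icc (-(N : ℤ)) (N : ℤ),
        ∫ u in a..b, f u *
          ∑ m ∈ Finset.Icc (1 : ℤ) ⌊b⌋, (1 / (m : ℂ)) * ee ((n : ℂ) * (u : ℂ) / (m : ℂ)))
      atTop
      (nhds (∑ n ∈ Finset.Ioc ⌊a⌋ ⌊b⌋, (n.toNat.divisors.card : ℂ) * f (n : ℝ))) := by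
  have hc := hf.continuousOn
  have hm0 : ∀ m ∈ Finset.Icc (1 : ℤ) ⌊b⌋, 0 < m := fun m hm => by
    linarith [(Finset.mem_Icc.1 hm).1]
  have hswap : ∀ n : ℤ, ∫ u in a..b, f u *
      ∑ m ∈ Finset.Icc (1 : ℤ) ⌊b⌋, (1 / (m : ℂ)) * ee ((n : ℂ) * (u : ℂ) / (m : ℂ)) =
      ∑ m ∈ Finset.Icc (1 : ℤ) ⌊b⌋,
        ∫ v in a / m..b / m, f (m * v) * ee ((n : ℂ) * (v : ℂ)) := by
    intro n
    simp_rw [Finset.mul_sum]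
    rw [intervalIntegral.integral_finsetSum]
    · exact Finset.sum_congr rfl fun m hm =>
        integral_mul_inv_mul_ee_div f a b (hm0 m hm).ne' n
    · intro m _
      refine ContinuousOn.intervalIntegrable_of_Icc hab.le (hc.mul ?_)
      fun_prop
  simp_rw [hswap]
  rw [← sum_sum_Ioc_floor_div_eq_sum_card_divisors f ha0]
  simp_rw [Finset.sum_comm (s := Finset.Icc (-(_ : ℤ)) _)]
  refine tendsto_finsetSum _ fun m hm => ?_
  have hm' : (0 : ℝ) < m := Int.cast_pos.2 (hm0 m hm)
  have hne : ∀ {x : ℝ}, (∀ n : ℤ, x ≠ n) → ∀ n : ℤ, x / m ≠ n := by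
    intro x hx n h
    refine hx (n * m) ?_
    rw [div_eq_iff hm'.ne'] at h
    rw [h, Int.cast_mul]
  refine tendsto_sum_integral_mul_ee (g := fun v => f (m * v))
    (div_le_div_of_nonneg_right hab.le hm'.le) (hne ha) (hne hb) ?_ ?_
  · refine hc.comp (by fun_prop) fun v hv => ?_
    rwa [Set.mem_Icc, div_le_iff₀' hm', le_div_iff₀' hm'] at hv
  · intro v hv
    rw [Set.mem_Ioo, div_lt_iff₀' hm', lt_div_iff₀' hm'] at hv
    have hd : DifferentiableAt ℝ f (m * v) :=
      (hf.differentiableOn one_ne_zero).differentiableAt (Icc_mem_nhds hv.1 hv.2)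
    exact hd.comp v (by fun_prop)
end
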